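/- Let u_1, u_2 be finite data words with u_2 nonempty and let w = u_1(u_2)^ω_{+0} = u_1 u_2 u_2 u_2 ⋯. Then for every position i ≥ |u_1|, every TPTL formula φ, and every register valuation ν: (w,i,ν) ⊨ φ if and only if (w,i+|u_2|,ν) ⊨ φ. -/

import Mathlib

/-- Comparison operators `<, ≤, =, ≥, >`. -/
inductive CmpOp : Type
  | lt | le | eq | ge | gt
  deriving DecidableEq

/-- `CmpOp.eval r a c` means `a ∼ c` for the comparison `∼` denoted by `r`. -/
def CmpOp.eval : CmpOp → ℤ → ℤ → Prop
  | .lt, a, c => a < c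
  | .le, a, c => a ≤ c
  | .eq, a, c => a = c
  | .ge, a, c => c ≤ a
  | .gt, a, c => c < a

/-- TPTL formulas over atomic propositions `α` and register variables `V`. -/
inductive TPTL (α V : Type) : Type
  | tt : TPTL α V
  | atom : α → TPTL α V
  | cmp : V → CmpOp → ℤ → TPTL α V
  | not : TPTL α V → TPTL α V
  | and : TPTL α V → TPTL α V → TPTL α V
  | until_ : TPTL α V → TPTL α V → TPTL α V
  | freeze : V → TPTL α V → TPTL α V

/-- A (finite or infinite) data word: a length in `ℕ∞` together with, for every
position, a set of atomic propositions and a data value in `ℕ`. -/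
structure DataWord (α : Type) where
  len : ℕ∞
  val : ℕ → Set α × ℕ

namespace DataWord
variable {α : Type}
/-- Propositions holding at position `i`. -/
def props (w : DataWord α) (i : ℕ) : Set α := (w.val i).1
/-- Data value at position `i` (as an integer). -/
def data (w : DataWord α) (i : ℕ) : ℤ := ((w.val i).2 : ℤ)
/-- `i` is a position of `w`. -/
def Pos (w : DataWord α) (i : ℕ) : Prop := (i : ℕ∞) < w.len
end DataWord

/-- The TPTL satisfaction relation `(w,i,ν) ⊨ φ`. -/
def TPTL.sat {α V : Type} [DecidableEq V] (w : DataWord α) :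
    TPTL α V → ℕ → (V → ℤ) → Prop
  | .tt, _, _ => True
  | .atom p, i, _ => p ∈ w.props i
  | .cmp x r c, i, ν => r.eval (w.data i - ν x) c
  | .not φ, i, ν => ¬ TPTL.sat w φ i ν
  | .and φ ψ, i, ν => TPTL.sat w φ i ν ∧ TPTL.sat w ψ i ν
  | .until_ φ ψ, i, ν => ∃ j, i < j ∧ w.Pos j ∧ TPTL.sat w ψ j ν ∧
      ∀ t, i < t → t < j → TPTL.sat w φ t ν
  | .freeze x φ, i, ν => TPTL.sat w φ i (Function.update ν x (w.data i))

/-- The relative TPTL satisfaction relation `(w,i,δ) ⊨rel φ`. -/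
def TPTL.satRel {α V : Type} [DecidableEq V] (w : DataWord α) :
    TPTL α V → ℕ → (V → ℤ) → Prop
  | .tt, _, _ => True
  | .atom p, i, _ => p ∈ w.props i
  | .cmp x r c, _, δ => r.eval (δ x) c
  | .not φ, i, δ => ¬ TPTL.satRel w φ i δ
  | .and φ ψ, i, δ => TPTL.satRel w φ i δ ∧ TPTL.satRel w ψ i δ
  | .until_ φ ψ, i, δ => ∃ j, i < j ∧ w.Pos j ∧
      TPTL.satRel w ψ j (fun y => δ y + (w.data j - w.data i)) ∧
      ∀ t, i < t → t < j → TPTL.satRel w φ t (fun y => δ y + (w.data t - w.data i))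
  | .freeze x φ, i, δ => TPTL.satRel w φ i (Function.update δ x 0)

/-- The infinite data word `u₁ (u₂)^ω_{+k}`. -/
def omegaWord {α : Type} (u₁ u₂ : List (Set α × ℕ)) (k : ℕ) : DataWord α :=
  ⟨⊤, fun i =>
    if i < u₁.length then u₁.getD i (∅, 0)
    else
      let j := i - u₁.length
      let p := u₂.getD (j % u₂.length) (∅, 0)
      (p.1, p.2 + (j / u₂.length) * k)⟩

theorem omegaWord_val_shift {α : Type} (u₁ u₂ : List (Set α × ℕ)) (i : ℕ)
    (hi : u₁.length ≤ i) :
    (omegaWord u₁ u₂ 0).val (i + u₂.length) = (omegaWord u₁ u₂ 0).val i := by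
  have h1 : ¬ (i < u₁.length) := by omega
  have h2 : ¬ (i + u₂.length < u₁.length) := by omega
  have h3 : i + u₂.length - u₁.length = (i - u₁.length) + u₂.length := by omega
  simp only [omegaWord, if_neg h1, if_neg h2, h3, Nat.add_mod_right, Nat.mul_zero]

/-- For `w = u₁(u₂)^ω_{+0} = u₁ u₂ u₂ u₂ ⋯` and any position `i ≥ |u₁|`:
`(w,i,ν) ⊨ φ` iff `(w,i+|u₂|,ν) ⊨ φ`. -/
theorem sat_period_shift_zero {α V : Type} [DecidableEq V]
    (u₁ u₂ : List (Set α × ℕ)) (hu₂ : u₂ ≠ [])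
    (i : ℕ) (hi : u₁.length ≤ i) (φ : TPTL α V) (ν : V → ℤ) :
    TPTL.sat (omegaWord u₁ u₂ 0) φ i ν ↔
      TPTL.sat (omegaWord u₁ u₂ 0) φ (i + u₂.length) ν := by
  induction φ generalizing i ν with
  | tt => exact Iff.rfl
  | atom p =>
    simp only [TPTL.sat, DataWord.props, omegaWord_val_shift u₁ u₂ i hi]
  | cmp x r c =>
    simp only [TPTL.sat, DataWord.data, omegaWord_val_shift u₁ u₂ i hi]
  | not φ ih => exact not_congr (ih i hi ν)
  | and φ ψ ih1 ih2 => exact and_congr (ih1 i hi ν) (ih2 i hi ν)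
  | freeze x φ ih =>
    have h : (omegaWord u₁ u₂ 0).data (i + u₂.length) = (omegaWord u₁ u₂ 0).data i := by
      simp only [DataWord.data, omegaWord_val_shift u₁ u₂ i hi]
    simp only [TPTL.sat, h]
    exact ih i hi _
  | until_ φ ψ ih1 ih2 =>
    have hpos : ∀ j, (omegaWord u₁ u₂ 0).Pos j := fun j => ENat.coe_lt_top j
    simp only [TPTL.sat]
    constructor
    · rintro ⟨j, hij, -, hj, ht⟩
      refine ⟨j + u₂.length, by omega, hpos _, (ih2 j (by omega) ν).1 hj, ?_⟩
      intro t h1 h2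
      obtain ⟨s, rfl⟩ : ∃ s, t = s + u₂.length := ⟨t - u₂.length, by omega⟩
      exact (ih1 s (by omega) ν).1 (ht s (by omega) (by omega))
    · rintro ⟨j, hij, -, hj, ht⟩
      obtain ⟨s, rfl⟩ : ∃ s, j = s + u₂.length := ⟨j - u₂.length, by omega⟩
      refine ⟨s, by omega, hpos _, (ih2 s (by omega) ν).2 hj, ?_⟩
      intro t h1 h2
      exact (ih1 t (by omega) ν).2 (ht (t + u₂.length) (by omega) (by omega))
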